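/- Let z be an irrational real number with ⌈ ⌉-convergents s_j/t_j and ⌊ ⌋-convergents p_k/q_k. Then there are infinitely many indices j ≥ 1 such that s_j/t_j equals p_k/q_k for some k ≥ 0; that is, infinitely many ⌈ ⌉-convergents of z are ⌊ ⌋-convergents of z. -/

import Mathlib

open Filter Finset

/-- Complete quotients of the regular continued fraction: `rX z n` is `z_n`,
with `z_0 = z` and `z_{n+1} = 1/(z_n - ⌊z_n⌋)`. -/
noncomputable def rXaux : ℕ → ℝ → ℝ
  | 0, z => z
  | n + 1, z => rXaux n (1 / (z - ⌊z⌋))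

noncomputable def rX (z : ℝ) (n : ℕ) : ℝ := rXaux n z

/-- Partial quotients of the regular continued fraction: `rA z n` is `a_n = ⌊z_n⌋`. -/
noncomputable def rA (z : ℝ) (n : ℕ) : ℤ := ⌊rX z n⌋

/-- Numerators of the regular (⌊ ⌋-)convergents, with shifted index:
`rP z 0 = p_{-1} = 1` and `rP z (k+1) = p_k`. -/
noncomputable def rP (z : ℝ) : ℕ → ℤ
  | 0 => 1
  | 1 => rA z 0
  | n + 2 => rA z (n + 1) * rP z (n + 1) + rP z n

/-- Denominators of the regular (⌊ ⌋-)convergents, with shifted index: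
`rQ z 0 = q_{-1} = 0` and `rQ z (k+1) = q_k`. -/
noncomputable def rQ (z : ℝ) : ℕ → ℤ
  | 0 => 0
  | 1 => 1
  | n + 2 => rA z (n + 1) * rQ z (n + 1) + rQ z n

/-- Complete quotients of the negative regular continued fraction: `nX z n` is `z_n`,
with `z_0 = z` and `z_{n+1} = 1/(⌈z_n⌉ - z_n)`. -/
noncomputable def nXaux : ℕ → ℝ → ℝ
  | 0, z => z
  | n + 1, z => nXaux n (1 / (⌈z⌉ - z))

noncomputable def nX (z : ℝ) (n : ℕ) : ℝ := nXaux n z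

/-- Partial quotients of the negative regular continued fraction: `nC z n` is `c_n = ⌈z_n⌉`. -/
noncomputable def nC (z : ℝ) (n : ℕ) : ℤ := ⌈nX z n⌉

/-- Numerators of the negative regular (⌈ ⌉-)convergents, with shifted index:
`nS z 0 = s_{-1} = 1` and `nS z (j+1) = s_j`. -/
noncomputable def nS (z : ℝ) : ℕ → ℤ
  | 0 => 1
  | 1 => nC z 0
  | n + 2 => nC z (n + 1) * nS z (n + 1) - nS z n

/-- Denominators of the negative regular (⌈ ⌉-)convergents, with shifted index:
`nT z 0 = t_{-1} = 0` and `nT z (j+1) = t_j`. -/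
noncomputable def nT (z : ℝ) : ℕ → ℤ
  | 0 => 0
  | 1 => 1
  | n + 2 => nC z (n + 1) * nT z (n + 1) - nT z n

theorem rX_succ (z : ℝ) (n : ℕ) : rX z (n + 1) = 1 / (rX z n - ⌊rX z n⌋) := by
  induction n generalizing z with
  | zero => rfl
  | succ n ih => exact ih (1 / (z - ⌊z⌋))

theorem nX_succ (z : ℝ) (n : ℕ) : nX z (n + 1) = 1 / (⌈nX z n⌉ - nX z n) := by
  induction n generalizing z with
  | zero => rfl
  | succ n ih => exact ih (1 / (⌈z⌉ - z))

theorem irrational_rX {z : ℝ} (hz : Irrational z) (n : ℕ) : Irrational (rX z n) := by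
  induction n with
  | zero => exact hz
  | succ n ih =>
    rw [rX_succ, one_div]
    exact (ih.sub_intCast _).inv

theorem Irrational.floor_lt {x : ℝ} (hx : Irrational x) : (⌊x⌋ : ℝ) < x :=
  (Int.floor_le x).lt_of_ne (hx.ne_int _).symm

theorem Irrational.ceil_eq_floor_add_one {x : ℝ} (hx : Irrational x) : ⌈x⌉ = ⌊x⌋ + 1 := by
  rw [Int.ceil_eq_iff]
  push_cast
  exact ⟨by linarith [hx.floor_lt], (Int.lt_floor_add_one x).le⟩

theorem one_lt_rX_succ {z : ℝ} (hz : Irrational z) (n : ℕ) : 1 < rX z (n + 1) := by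
  rw [rX_succ, lt_div_iff₀ (by linarith [(irrational_rX hz n).floor_lt])]
  linarith [Int.lt_floor_add_one (rX z n)]

theorem one_le_rA_succ {z : ℝ} (hz : Irrational z) (n : ℕ) : 1 ≤ rA z (n + 1) := by
  rw [rA, Int.le_floor]
  exact_mod_cast (one_lt_rX_succ hz n).le

/-- The shifted index of the ⌈ ⌉-convergent that agrees with the ⌊ ⌋-convergent of
shifted index `2 * k`, namely `a_1 + a_3 + ⋯ + a_{2k-1}`. -/
noncomputable def oddIndex (z : ℝ) : ℕ → ℕ
  | 0 => 0
  | k + 1 => oddIndex z k + (rA z (2 * k + 1)).toNat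

theorem le_oddIndex {z : ℝ} (hz : Irrational z) (k : ℕ) : k ≤ oddIndex z k := by
  induction k with
  | zero => exact Nat.zero_le _
  | succ k ih =>
    have := one_le_rA_succ hz (2 * k)
    simp only [oddIndex]
    omega

/-- The negative algorithm sends `y / (y - 1)` to `(y - i) / (y - i - 1)` in `i` steps
if `i + 1 < y`. -/
theorem nX_run {z y : ℝ} {m : ℕ} (h : nX z m = 1 + 1 / (y - 1)) (i : ℕ) (hi : i + 1 < y) :
    nX z (m + i) = 1 + 1 / (y - i - 1) := by
  induction i with
  | zero => simpa using h
  | succ i ih =>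
    push_cast at hi ⊢
    have hpos : 0 < y - i - 1 := by linarith
    have hceil : ⌈nX z (m + i)⌉ = 2 := by
      have h0 : 0 < 1 / (y - i - 1) := by positivity
      have h1 : 1 / (y - i - 1) ≤ 1 := by
        rw [div_le_one hpos]
        linarith
      rw [ih (by linarith), Int.ceil_eq_iff]
      push_cast
      constructor <;> linarith
    have hne' : y - (i + 1) - 1 ≠ 0 := by linarith
    rw [← add_assoc, nX_succ, hceil, ih (by linarith)]
    have hrw : ((2 : ℤ) : ℝ) - (1 + 1 / (y - i - 1)) = (y - (i + 1) - 1) / (y - i - 1) := by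
      field_simp
      push_cast
      ring
    rw [hrw, one_div_div]
    field_simp
    ring

theorem nC_run {z y : ℝ} {m : ℕ} (h : nX z m = 1 + 1 / (y - 1)) (i : ℕ) (hi : i + 2 < y) :
    nC z (m + i) = 2 := by
  have hpos : 0 < y - i - 1 := by linarith
  have h0 : 0 < 1 / (y - i - 1) := by positivity
  have h1 : 1 / (y - i - 1) ≤ 1 := by
    rw [div_le_one hpos]
    linarith
  rw [nC, nX_run h i (by linarith), Int.ceil_eq_iff]
  push_cast
  constructor <;> linarith

/-- If a negative complete quotient lies as far below its ceiling as a regular one does, then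
the next negative complete quotient is determined by the next regular one. -/
theorem nX_succ_of_ceil_sub {z : ℝ} (hz : Irrational z) {m n : ℕ}
    (h : (⌈nX z m⌉ : ℝ) - nX z m = ⌊rX z n⌋ + 1 - rX z n) :
    nX z (m + 1) = 1 + 1 / (rX z (n + 1) - 1) := by
  have h0 := (irrational_rX hz n).floor_lt
  have h1 := Int.lt_floor_add_one (rX z n)
  rw [nX_succ, h, rX_succ]
  have e1 : rX z n - ⌊rX z n⌋ ≠ 0 := by linarith
  have e2 : ⌊rX z n⌋ + 1 - rX z n ≠ 0 := by linarith
  have hrw : 1 / (rX z n - ⌊rX z n⌋) - 1 =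
      (⌊rX z n⌋ + 1 - rX z n) / (rX z n - ⌊rX z n⌋) := by
    field_simp
    ring
  rw [hrw, one_div_div]
  field_simp
  ring

/-- The end of a run of twos. -/
theorem nX_add_rA {z : ℝ} (hz : Irrational z) {m n : ℕ}
    (h : nX z (m + 1) = 1 + 1 / (rX z (n + 1) - 1)) :
    nX z (m + (rA z (n + 1)).toNat) = 1 + rX z (n + 2) := by
  have hb := one_le_rA_succ hz n
  obtain ⟨b, hb'⟩ : ∃ b : ℕ, rA z (n + 1) = b + 1 := ⟨(rA z (n + 1) - 1).toNat, by omega⟩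
  have hfl : (⌊rX z (n + 1)⌋ : ℝ) = b + 1 := by exact_mod_cast hb'
  have hlt := (irrational_rX hz (n + 1)).floor_lt
  rw [hfl] at hlt
  have hidx : m + (rA z (n + 1)).toNat = m + 1 + b := by omega
  rw [hidx, nX_run h b hlt, rX_succ z (n + 1), hfl, sub_sub]

theorem ceil_one_add_rX {z : ℝ} (hz : Irrational z) (n : ℕ) :
    ⌈1 + rX z n⌉ = rA z n + 2 := by
  rw [add_comm, Int.ceil_add_one, (irrational_rX hz n).ceil_eq_floor_add_one, rA]
  ring

theorem nX_oddIndex_add_one {z : ℝ} (hz : Irrational z) (k : ℕ) :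
    nX z (oddIndex z k + 1) = 1 + 1 / (rX z (2 * k + 1) - 1) := by
  induction k with
  | zero =>
    apply nX_succ_of_ceil_sub hz
    change (⌈z⌉ : ℝ) - z = ⌊z⌋ + 1 - z
    rw [hz.ceil_eq_floor_add_one]
    push_cast
    ring
  | succ k ih =>
    apply nX_succ_of_ceil_sub hz
    rw [oddIndex, nX_add_rA hz ih, ceil_one_add_rX hz, rA]
    push_cast
    ring_nf

theorem nC_oddIndex_succ {z : ℝ} (hz : Irrational z) (k : ℕ) :
    nC z (oddIndex z (k + 1)) = rA z (2 * k + 2) + 2 := by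
  rw [nC, oddIndex, nX_add_rA hz (nX_oddIndex_add_one hz k), ceil_one_add_rX hz]

theorem nC_oddIndex_add {z : ℝ} (hz : Irrational z) (k i : ℕ) (hi : i + 2 ≤ rA z (2 * k + 1)) :
    nC z (oddIndex z k + 1 + i) = 2 := by
  apply nC_run (nX_oddIndex_add_one hz k)
  refine lt_of_le_of_lt ?_ (irrational_rX hz (2 * k + 1)).floor_lt
  exact_mod_cast hi

/-- A solution `v` of the recurrence of the negative expansion, with initial values matched to
a solution `u` of the recurrence of the regular expansion, agrees with `u` along
`oddIndex`. -/
theorem recurrence_oddIndex {z : ℝ} (hz : Irrational z) {u v : ℕ → ℤ}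
    (hu : ∀ n, u (n + 2) = rA z (n + 1) * u (n + 1) + u n)
    (hv : ∀ n, v (n + 2) = nC z (n + 1) * v (n + 1) - v n)
    (h0 : v 0 = u 0) (h1 : v 1 = u 1 + u 0) (k : ℕ) :
    v (oddIndex z k) = u (2 * k) ∧ v (oddIndex z k + 1) = u (2 * k + 1) + u (2 * k) := by
  induction k with
  | zero => exact ⟨h0, h1⟩
  | succ k ih =>
    have run : ∀ i : ℕ, i + 1 ≤ rA z (2 * k + 1) →
        v (oddIndex z k + i) = u (2 * k) + i * u (2 * k + 1) ∧
        v (oddIndex z k + i + 1) = u (2 * k) + (i + 1) * u (2 * k + 1) := by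
      intro i
      induction i with
      | zero =>
        intro _
        refine ⟨by simpa using ih.1, ?_⟩
        rw [add_zero, ih.2]
        push_cast
        ring
      | succ i ihi =>
        intro hi
        push_cast at hi
        obtain ⟨h2, h3⟩ := ihi (by omega)
        refine ⟨by push_cast; exact h3, ?_⟩
        have hc := nC_oddIndex_add hz k i (by omega)
        have hidx : oddIndex z k + (i + 1) + 1 = oddIndex z k + i + 2 := by ring
        have hidx' : oddIndex z k + 1 + i = oddIndex z k + i + 1 := by ring
        rw [hidx, hv, ← hidx', hc, hidx', h2, h3]
        push_cast
        ring
    have hb := one_le_rA_succ hz (2 * k)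
    obtain ⟨b, hb'⟩ : ∃ b : ℕ, rA z (2 * k + 1) = b + 1 :=
      ⟨(rA z (2 * k + 1) - 1).toNat, by omega⟩
    obtain ⟨h2, h3⟩ := run b (by omega)
    have hidx : oddIndex z (k + 1) = oddIndex z k + b + 1 := by
      rw [oddIndex]
      omega
    have hc := nC_oddIndex_succ hz k
    have hu2 := hu (2 * k)
    have hu3 := hu (2 * k + 1)
    rw [hidx] at hc ⊢
    rw [hb'] at hu2
    have hfst : v (oddIndex z k + b + 1) = u (2 * (k + 1)) := by
      rw [h3, mul_add_one, hu2]
      ring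
    refine ⟨hfst, ?_⟩
    rw [hv, hc, h2, h3]
    rw [mul_add_one, hu3, hu2]
    ring

/-- For irrational `z`, infinitely many ⌈ ⌉-convergents `s_j/t_j` (j ≥ 1)
are ⌊ ⌋-convergents `p_k/q_k` of `z`. -/
theorem stmt1 (z : ℝ) (hz : Irrational z) :
    {j : ℕ | 1 ≤ j ∧ ∃ k : ℕ,
      (nS z (j + 1) : ℝ) / (nT z (j + 1) : ℝ) = (rP z (k + 1) : ℝ) / (rQ z (k + 1) : ℝ)}.Infinite := by
  refine Set.infinite_of_forall_exists_gt fun n => ?_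
  have hle := le_oddIndex hz (n + 2)
  obtain ⟨j, hj⟩ : ∃ j, oddIndex z (n + 2) = j + 1 := ⟨oddIndex z (n + 2) - 1, by omega⟩
  have hS := (recurrence_oddIndex hz (u := rP z) (v := nS z) (fun _ => rfl) (fun _ => rfl) rfl
    (hz.ceil_eq_floor_add_one) (n + 2)).1
  have hT := (recurrence_oddIndex hz (u := rQ z) (v := nT z) (fun _ => rfl) (fun _ => rfl) rfl
    rfl (n + 2)).1
  rw [hj] at hS hT
  refine ⟨j, ⟨by omega, 2 * n + 3, ?_⟩, by omega⟩
  rw [hS, hT]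
  rfl
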